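/- Let n ≥ 4 be an even integer. There do not exist permutations σ₁, σ₂, σ₃, σ₄ of {1,…,n} such that: σ₁ has full cycle type consisting of one 1, one 3, and (n−4)/2 copies of 2; each of σ₂, σ₃, σ₄ is a fixed-point-free involution (full cycle type consisting of n/2 copies of 2); and σ₁σ₂σ₃σ₄ = 1. (In particular, the genus-1 ramification type [1,3,2^*][2^*][2^*][2^*] is not realizable in any degree.) -/

import Mathlib

/-- The full cycle type of a permutation of a finite set: the multiset of the lengths of its
cycles, where each fixed point counts as a cycle of length 1. -/
def fullCycleType {α : Type*} [Fintype α] [DecidableEq α] (σ : Equiv.Perm α) : Multiset ℕ :=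
  σ.cycleType + Multiset.replicate (Fintype.card α - σ.cycleType.sum) 1

/-- The subgroup generated by a set of permutations acts transitively. -/
def IsTransitiveSet {α : Type*} (s : Set (Equiv.Perm α)) : Prop :=
  ∀ x y : α, ∃ g ∈ Subgroup.closure s, g x = y

/-- A ramification data, given as a list of multisets of positive integers (partitions of `n`),
is realizable if there are permutations of `{1,…,n}` with product 1, generating a transitive
subgroup, whose full cycle types are the given multisets. -/
def Realizable (n : ℕ) (E : List (Multiset ℕ)) : Prop :=
  ∃ σ : List (Equiv.Perm (Fin n)),
    σ.map fullCycleType = E ∧ σ.prod = 1 ∧ IsTransitiveSet {g | g ∈ σ}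

open Equiv.Perm in
theorem conj_zpow_apply {α : Type*} {t g : Equiv.Perm α} {x : α}
    (h : ∀ z, SameCycle t x z → g (t⁻¹ z) = t (g z)) (j : ℤ) :
    g ((t ^ j) x) = (t ^ (-j)) (g x) := by
  induction j with
  | zero => simp
  | succ i ih =>
    have := h ((t ^ ((i : ℤ) + 1)) x) ⟨_, rfl⟩
    rw [← Equiv.Perm.mul_apply t⁻¹, ← zpow_neg_one, ← zpow_add, neg_add_cancel_comm_assoc,
      ih] at this
    rw [neg_add_rev, zpow_add t (-1), Equiv.Perm.mul_apply, this]
    simp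
  | pred i ih =>
    have := h ((t ^ (-(i : ℤ))) x) ⟨_, rfl⟩
    rw [sub_eq_neg_add, zpow_add, Equiv.Perm.mul_apply, zpow_neg_one, this, ih,
      ← Equiv.Perm.mul_apply, ← zpow_one_add]
    congr 2
    ring

open Equiv.Perm in
/-- A fixed-point-free involution reversing a cycle of `t` maps it to a different cycle, if `t * g`
has at most one fixed point on it. -/
theorem not_sameCycle_of_reverse {α : Type*} [Finite α] {t g : Equiv.Perm α} {x : α}
    (h : ∀ z, SameCycle t x z → g (t⁻¹ z) = t (g z)) (hg : ∀ z, g z ≠ z)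
    (hu : ∀ y z, t (g y) = y → t (g z) = z → y = z) : ¬ SameCycle t x (g x) := by
  have hev : ∀ j : ℤ, (t ^ (j + j)) x ≠ g x := by
    intro j hj
    refine hg ((t ^ j) x) ?_
    rw [conj_zpow_apply h, ← hj, ← Equiv.Perm.mul_apply, ← zpow_add]
    congr 2
    ring
  have hodd : ∀ j : ℤ, (t ^ (j + j - 1)) x = g x → t (g ((t ^ j) x)) = (t ^ j) x := by
    intro j hj
    rw [conj_zpow_apply h, ← hj, ← Equiv.Perm.mul_apply (t ^ (-j)), ← zpow_add,
      ← Equiv.Perm.mul_apply, ← zpow_one_add]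
    congr 2
    ring
  rintro ⟨i, hi⟩
  have hpos : 0 < Function.minimalPeriod t x :=
    Function.minimalPeriod_pos_of_mem_periodicPts
      (Function.Injective.mem_periodicPts t.injective x)
  have hper : (t ^ ((Function.minimalPeriod t x : ℕ) : ℤ)) x = x := by
    rw [zpow_natCast, ← Equiv.Perm.iterate_eq_pow]
    exact Function.iterate_minimalPeriod
  have hi' : (t ^ (i + (Function.minimalPeriod t x : ℕ))) x = g x := by
    rw [zpow_add, Equiv.Perm.mul_apply, hper, hi]
  have hmin : ∀ l : ℕ, 0 < l → (t ^ (l : ℤ)) x = x → Function.minimalPeriod t x ≤ l := by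
    intro l hl hx
    refine Function.IsPeriodicPt.minimalPeriod_le hl ?_
    rwa [zpow_natCast, ← Equiv.Perm.iterate_eq_pow] at hx
  generalize Function.minimalPeriod t x = L at *
  rcases Int.even_or_odd' i with ⟨j, rfl | rfl⟩
  · exact hev j (by rw [← two_mul]; exact hi)
  · rcases Nat.even_or_odd' L with ⟨l, rfl | rfl⟩
    · have h1 := hodd (j + 1) (by rw [← hi]; congr 2; ring)
      have h2 := hodd (j + 1 + l) (by rw [← hi']; congr 2; push_cast; ring)
      have h3 := hu _ _ h1 h2
      rw [zpow_add t (j + 1), Equiv.Perm.mul_apply] at h3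
      have := hmin l (by omega) ((t ^ (j + 1)).injective h3).symm
      omega
    · exact hev (j + l + 1) (by rw [← hi']; congr 2; push_cast; ring)

/-- The cycle of `t` through `x` as a finite set. -/
noncomputable def orbitFinset {α : Type*} [Fintype α] (t : Equiv.Perm α) (x : α) : Finset α :=
  open Classical in {y | t.SameCycle x y}

theorem mem_orbitFinset {α : Type*} [Fintype α] {t : Equiv.Perm α} {x y : α} :
    y ∈ orbitFinset t x ↔ t.SameCycle x y := by
  simp [orbitFinset]

theorem orbitFinset_eq_iff {α : Type*} [Fintype α] {t : Equiv.Perm α} {x y : α} :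
    orbitFinset t x = orbitFinset t y ↔ t.SameCycle x y := by
  refine ⟨fun h => ?_, fun h => ?_⟩
  · rw [← mem_orbitFinset, h, mem_orbitFinset]
  · ext z
    rw [mem_orbitFinset, mem_orbitFinset]
    exact ⟨h.symm.trans, h.trans⟩

open Equiv.Perm in
theorem image_orbitFinset {α : Type*} [Fintype α] [DecidableEq α] {t g : Equiv.Perm α} {x : α}
    (h : ∀ z, SameCycle t x z → g (t⁻¹ z) = t (g z)) :
    (orbitFinset t x).image g = orbitFinset t (g x) := by
  ext y
  simp only [Finset.mem_image, mem_orbitFinset]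
  constructor
  · rintro ⟨z, ⟨j, rfl⟩, rfl⟩
    exact ⟨-j, (conj_zpow_apply h j).symm⟩
  · rintro ⟨j, rfl⟩
    exact ⟨(t ^ (-j)) x, ⟨_, rfl⟩, by rw [conj_zpow_apply h, neg_neg]⟩

theorem even_card_of_image_involution {α : Type*} [DecidableEq α] (S : Finset (Finset α))
    (g : Equiv.Perm α) (hgg : ∀ x, g (g x) = x)
    (hS : ∀ C ∈ S, C.image g ∈ S ∧ C.image g ≠ C) : Even S.card := by
  have h : ∑ _C ∈ S, (1 : ZMod 2) = 0 := by
    refine Finset.sum_involution (fun C _ => C.image g) (fun _ _ => by decide)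
      (fun C hC _ => (hS C hC).2) (fun C hC => (hS C hC).1) (fun C _ => ?_)
    rw [Finset.image_image]
    rw [show g ∘ g = id from funext hgg, Finset.image_id]
  rw [Finset.sum_const, nsmul_one] at h
  exact (ZMod.natCast_eq_zero_iff_even).1 h

open Equiv.Perm in
/-- If all cycles of `t` meeting the invariant set `U` are reversed by the fixed-point-free
involution `g`, they come in pairs of equal size. -/
theorem even_card_orbits {α : Type*} [Fintype α] [DecidableEq α] {t g : Equiv.Perm α}
    (U : Set α) (hgg : ∀ z, g (g z) = z) (hg : ∀ z, g z ≠ z)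
    (hu : ∀ y z, t (g y) = y → t (g z) = z → y = z)
    (hU : ∀ x ∈ U, g x ∈ U) (h : ∀ x ∈ U, ∀ z, SameCycle t x z → g (t⁻¹ z) = t (g z))
    (S : Finset (Finset α)) (P : ℕ → Prop)
    (hS : ∀ C, C ∈ S ↔ P C.card ∧ ∃ x ∈ U, orbitFinset t x = C) : Even S.card := by
  refine even_card_of_image_involution S g hgg fun C hC => ?_
  obtain ⟨hP, x, hx, rfl⟩ := (hS C).1 hC
  refine ⟨(hS _).2 ⟨?_, g x, hU x hx, (image_orbitFinset (h x hx)).symm⟩, fun he => ?_⟩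
  · rwa [Finset.card_image_of_injective _ g.injective]
  · rw [image_orbitFinset (h x hx), eq_comm, orbitFinset_eq_iff] at he
    exact not_sameCycle_of_reverse (h x hx) hg hu he

open Equiv.Perm in
theorem card_orbit_lt_card_orbit {α : Type*} [Fintype α] [DecidableEq α] {t c s : Equiv.Perm α}
    {p q r : α} (htc : ∀ x, t (c x) = s x) (hcc : ∀ x, c (c x) = x)
    (hpq : s p = q) (hqr : s q = r) (hpr : p ≠ r)
    (hs : ∀ x, x ≠ p → x ≠ q → x ≠ r → s (s x) = x)
    (h1 : SameCycle t p r) (h2 : ¬ SameCycle t p q) :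
    (orbitFinset t q).card < (orbitFinset t p).card := by
  classical
  have hex : ∃ m : ℕ, (t ^ m) p = r := h1.exists_nat_pow_eq
  obtain ⟨m, hm, hmin⟩ : ∃ m : ℕ, (t ^ m) p = r ∧ ∀ k < m, (t ^ k) p ≠ r :=
    ⟨Nat.find hex, Nat.find_spec hex, fun k hk => Nat.find_min hex hk⟩
  have hne : ∀ j, 0 < j → j ≤ m → (t ^ j) p ≠ p := by
    intro j hj hjm he
    refine hmin (m - j) (by omega) ?_
    rw [← hm]
    conv_rhs => rw [show m = (m - j) + j by omega, pow_add, Equiv.Perm.mul_apply, he]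
  have hwalk : ∀ j < m, (t ^ (j + 1)) (c ((t ^ j) p)) = q := by
    intro j
    induction j with
    | zero => intro _; simpa [htc] using hpq
    | succ j ih =>
      intro hj
      rw [← ih (by omega), pow_succ t (j + 1), Equiv.Perm.mul_apply]
      congr 1
      have h3 := hs ((t ^ (j + 1)) p) (hne _ (by omega) (by omega))
        (fun h => h2 ⟨(j + 1 : ℕ), by rw [zpow_natCast, h]⟩) (hmin _ hj)
      rw [htc, ← c.injective.eq_iff, hcc, ← t.injective.eq_iff, htc, h3, pow_succ',
        Equiv.Perm.mul_apply]
  have hm0 : m ≠ 0 := by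
    rintro rfl
    exact hpr (by simpa using hm)
  obtain ⟨k, rfl⟩ := Nat.exists_eq_succ_of_ne_zero hm0
  have hq : (t ^ (k + 1)) q = q := by
    conv_rhs => rw [← hwalk k (by omega)]
    congr 1
    rw [← c.injective.eq_iff, hcc, ← t.injective.eq_iff, htc, hqr, ← hm, pow_succ',
      Equiv.Perm.mul_apply]
  have hle : (orbitFinset t q).card ≤ k + 1 := by
    calc (orbitFinset t q).card ≤ ((Finset.range (k + 1)).image fun j => (t ^ j) q).card := by
          refine Finset.card_le_card fun y hy => ?_
          obtain ⟨j, rfl⟩ := (mem_orbitFinset.1 hy).exists_nat_pow_eq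
          refine Finset.mem_image.2 ⟨j % (k + 1), Finset.mem_range.2 (Nat.mod_lt _ (by omega)), ?_⟩
          conv_rhs => rw [← Nat.mod_add_div j (k + 1), pow_add, Equiv.Perm.mul_apply, pow_mul,
            Equiv.Perm.pow_apply_eq_self_of_apply_eq_self hq]
      _ ≤ k + 1 := by simpa using Finset.card_image_le (s := Finset.range (k + 1))
  have hinj : ∀ i j, i < j → j ≤ k + 1 → (t ^ i) p ≠ (t ^ j) p := by
    intro i j hij hj he
    refine hne (j - i) (by omega) (by omega) ((t ^ i).injective ?_)
    rw [← Equiv.Perm.mul_apply, ← pow_add, he]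
    congr 2
    omega
  have hge : k + 2 ≤ (orbitFinset t p).card := by
    calc k + 2 = ((Finset.range (k + 2)).image fun j => (t ^ j) p).card := by
          rw [Finset.card_image_of_injOn, Finset.card_range]
          intro i hi j hj he
          simp only [Finset.coe_range, Set.mem_Iio] at hi hj
          rcases lt_trichotomy i j with h | h | h
          · exact absurd he (hinj i j h (by omega))
          · exact h
          · exact absurd he.symm (hinj j i h (by omega))
      _ ≤ _ := by
          refine Finset.card_le_card fun y hy => ?_
          obtain ⟨j, -, rfl⟩ := Finset.mem_image.1 hy
          exact mem_orbitFinset.2 ⟨j, by simp⟩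
  omega

open Equiv.Perm in
theorem false_of_involutions {α : Type*} [Fintype α] [DecidableEq α] {a b c s : Equiv.Perm α}
    (habc : a * b * c = s) (haa : ∀ x, a (a x) = x) (ha : ∀ x, a x ≠ x)
    (hbb : ∀ x, b (b x) = x) (hb : ∀ x, b x ≠ x) (hcc : ∀ x, c (c x) = x) (hc : ∀ x, c x ≠ x)
    {p q r : α} (hpq : s p = q) (hqr : s q = r) (hrp : s r = p)
    (npq : p ≠ q) (nqr : q ≠ r) (nrp : r ≠ p)
    (hs : ∀ x, x ≠ p → x ≠ q → x ≠ r → s (s x) = x)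
    (hfix : ∀ x y, s x = x → s y = y → x = y) : False := by
  set t := a * b with ht
  have htc : ∀ x, t (c x) = s x := fun x => by rw [← habc]; rfl
  have hta : ∀ z, a (t⁻¹ z) = t (a z) := fun z => by
    obtain ⟨y, rfl⟩ := t.surjective z
    rw [Equiv.Perm.inv_def, Equiv.symm_apply_apply, ht, Equiv.Perm.mul_apply, Equiv.Perm.mul_apply, haa, hbb]
  have htc' : ∀ z, z ≠ p → z ≠ q → z ≠ r → c (t⁻¹ z) = t (c z) := fun z h1 h2 h3 => by
    rw [← c.injective.eq_iff, hcc, ← t.injective.eq_iff, Equiv.Perm.inv_def, Equiv.apply_symm_apply, htc, htc,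
      hs z h1 h2 h3]
  let O : (ℕ → Prop) → Finset (Finset α) := fun P =>
    open Classical in (Finset.univ.image (orbitFinset t)).filter fun C => P C.card
  let Q : Finset (Finset α) := {orbitFinset t p, orbitFinset t q, orbitFinset t r}
  have hO : ∀ P, Even (O P).card := fun P => by
    refine even_card_orbits (t := t) (g := a) Set.univ haa ha (fun y z hy => ?_)
      (fun _ _ => trivial) (fun _ _ z _ => hta z) _ P (fun C => ?_)
    · rw [← a.injective.eq_iff, ht, Equiv.Perm.mul_apply, haa] at hy
      exact absurd hy (hb _)
    · simp [O, and_comm]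
  have hrev : ∀ x, orbitFinset t x ∉ Q → ∀ z, SameCycle t x z → c (t⁻¹ z) = t (c z) := by
    intro x hx z hz
    have hz' := orbitFinset_eq_iff.2 hz
    refine htc' z ?_ ?_ ?_ <;> rintro rfl <;> exact hx (by simp [Q, hz'])
  have hcQ : ∀ x, orbitFinset t x ∉ Q → orbitFinset t (c x) ∉ Q := fun x hx => by
    have hstep : ∀ u v, s u = v → orbitFinset t (c x) = orbitFinset t u →
        orbitFinset t x = orbitFinset t v := by
      intro u v huv h
      have hu : u ∈ (orbitFinset t x).image c := by
        rw [image_orbitFinset (hrev x hx), mem_orbitFinset]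
        exact orbitFinset_eq_iff.1 h
      obtain ⟨z, hz, rfl⟩ := Finset.mem_image.1 hu
      rw [← htc, hcc] at huv
      rw [← huv, orbitFinset_eq_iff]
      exact Equiv.Perm.sameCycle_apply_right.2 (mem_orbitFinset.1 hz)
    have h1 := hstep _ _ hpq
    have h2 := hstep _ _ hqr
    have h3 := hstep _ _ hrp
    simp only [Q, Finset.mem_insert, Finset.mem_singleton] at hx ⊢
    tauto
  have hOQ : ∀ P, Even ((O P) \ Q).card := fun P => by
    refine even_card_orbits (t := t) (g := c) {x | orbitFinset t x ∉ Q} hcc hc (fun y z => ?_)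
      hcQ hrev _ P (fun C => ?_)
    · rw [htc, htc]
      exact hfix y z
    · simp only [O, Finset.mem_sdiff, Finset.mem_filter, Finset.mem_image, Finset.mem_univ,
        true_and, Set.mem_ofPred_eq]
      constructor
      · rintro ⟨⟨⟨x, rfl⟩, hP⟩, hQ⟩
        exact ⟨hP, x, hQ, rfl⟩
      · rintro ⟨hP, x, hQ, rfl⟩
        exact ⟨⟨⟨x, rfl⟩, hP⟩, hQ⟩
  have hQ : ∀ P : ℕ → Prop, open Classical in Even (Q.filter fun C => P C.card).card := fun P => by
    classical
    have h1 : Q.filter (fun C => P C.card) = O P ∩ Q := by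
      ext C
      have hC : C ∈ Q → ∃ x, orbitFinset t x = C := by
        simp only [Q, Finset.mem_insert, Finset.mem_singleton]
        rintro (rfl | rfl | rfl) <;> exact ⟨_, rfl⟩
      simp only [O, Finset.mem_inter, Finset.mem_filter, Finset.mem_image, Finset.mem_univ,
        true_and]
      tauto
    have h2 := Finset.card_sdiff_add_card_inter (O P) Q
    rw [h1]
    have := hO P
    rw [← h2] at this
    exact (Nat.even_add.1 this).1 (hOQ P)
  have key : ∀ A B : Finset α, Q = {A, B} → A ≠ B → A.card ≠ B.card → False := by
    intro A B hAB hne hcard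
    have := hQ (fun k => k = A.card)
    rw [hAB, Finset.filter_insert, Finset.filter_singleton, if_pos rfl, if_neg hcard.symm] at this
    simp at this
  have hcardQ : Even Q.card := by simpa using hQ fun _ => True
  have hns : ∀ {x y}, orbitFinset t x ≠ orbitFinset t y → ¬ SameCycle t x y :=
    fun h h' => h (orbitFinset_eq_iff.2 h')
  by_cases e1 : orbitFinset t p = orbitFinset t q <;>
  by_cases e2 : orbitFinset t q = orbitFinset t r
  · simp [Q, e1, e2] at hcardQ
  · exact key _ _ (by simp [Q, e1]) e2 (card_orbit_lt_card_orbit htc hcc hqr hrp npq.symm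
      (fun x h1 h2 h3 => hs x h3 h1 h2) (orbitFinset_eq_iff.1 e1.symm) (hns e2)).ne'
  · exact key _ _ (by simp [Q, e2]) (e2 ▸ e1) (card_orbit_lt_card_orbit htc hcc hrp hpq nqr.symm
      (fun x h1 h2 h3 => hs x h2 h3 h1) (orbitFinset_eq_iff.1 e2.symm)
      (hns fun h => e1 (h.symm.trans e2.symm))).ne
  · by_cases e3 : orbitFinset t p = orbitFinset t r
    · refine key _ _ ?_ e1 (card_orbit_lt_card_orbit htc hcc hpq hqr nrp.symm hs
        (orbitFinset_eq_iff.1 e3) (hns e1)).ne'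
      simp only [Q, ← e3]
      ext; simp; tauto
    · simp only [Q] at hcardQ
      rw [Finset.card_eq_three.2 ⟨_, _, _, e1, e3, e2, rfl⟩] at hcardQ
      exact absurd hcardQ (by decide)

theorem cycleType_eq_filter_fullCycleType {α : Type*} [Fintype α] [DecidableEq α]
    (σ : Equiv.Perm α) : σ.cycleType = (fullCycleType σ).filter (2 ≤ ·) := by
  rw [fullCycleType, Equiv.Perm.sum_cycleType]
  exact Equiv.Perm.filter_parts_partition_eq_cycleType.symm

theorem involution_of_fullCycleType {n : ℕ} (heven : Even n) {σ : Equiv.Perm (Fin n)}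
    (h : fullCycleType σ = Multiset.replicate (n / 2) 2) :
    (∀ x, σ (σ x) = x) ∧ ∀ x, σ x ≠ x := by
  have hc : σ.cycleType = Multiset.replicate (n / 2) 2 := by
    rw [cycleType_eq_filter_fullCycleType, h, Multiset.filter_eq_self]
    intro k hk
    rw [Multiset.eq_of_mem_replicate hk]
  constructor
  · have : σ ^ 2 = 1 := (Equiv.Perm.pow_prime_eq_one_iff (p := 2)).2 fun k hk =>
      Multiset.eq_of_mem_replicate (hc ▸ hk)
    intro x
    simpa [sq] using congrArg (· x) this
  · have hsum := σ.sum_cycleType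
    rw [hc, Multiset.sum_replicate, smul_eq_mul, Nat.div_mul_cancel heven.two_dvd] at hsum
    have : σ.support = Finset.univ := by
      rw [← Finset.card_eq_iff_eq_univ, ← hsum, Fintype.card_fin]
    intro x
    exact Equiv.Perm.mem_support.1 (this ▸ Finset.mem_univ x)

theorem exists_three_cycle_of_cycleType {α : Type*} [Fintype α] [DecidableEq α]
    {σ : Equiv.Perm α} {k : ℕ} (h : σ.cycleType = 3 ::ₘ Multiset.replicate k 2) :
    ∃ p q r, σ p = q ∧ σ q = r ∧ σ r = p ∧ p ≠ q ∧ q ≠ r ∧ r ≠ p ∧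
      ∀ x, x ≠ p → x ≠ q → x ≠ r → σ (σ x) = x := by
  obtain ⟨g, τ, rfl, hd, hg, hg3⟩ := Equiv.Perm.mem_cycleType_iff.1
    (show 3 ∈ σ.cycleType by rw [h]; exact Multiset.mem_cons_self _ _)
  rw [hd.cycleType_mul, hg.cycleType, hg3, Multiset.singleton_add, Multiset.cons_inj_right] at h
  have hτ : τ ^ 2 = 1 := (Equiv.Perm.pow_prime_eq_one_iff (p := 2)).2 fun k hk =>
    Multiset.eq_of_mem_replicate (h ▸ hk)
  have hτ' : ∀ x, τ (τ x) = x := fun x => by simpa [sq] using congrArg (· x) hτ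
  have h3 : g.IsThreeCycle := card_support_eq_three_iff.1 hg3
  have hgg : ∀ x, g (g (g x)) = x := fun x => by
    have := pow_orderOf_eq_one g
    rw [h3.orderOf] at this
    simpa [pow_succ] using congrArg (· x) this
  obtain ⟨p, hp⟩ : g.support.Nonempty := by
    rw [← Finset.card_pos, hg3]
    norm_num
  have hmem : ∀ x, x ∈ g.support → (g * τ) x = g x := fun x hx => by
    rw [Equiv.Perm.mul_apply, (hd x).resolve_left (Equiv.Perm.mem_support.1 hx)]
  have hq := Equiv.Perm.apply_mem_support.2 hp
  have hr := Equiv.Perm.apply_mem_support.2 hq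
  have npq := Equiv.Perm.mem_support.1 hp
  have nqr := Equiv.Perm.mem_support.1 hq
  have nrp := Equiv.Perm.mem_support.1 hr
  rw [hgg] at nrp
  refine ⟨p, g p, g (g p), hmem _ hp, hmem _ hq, (hmem _ hr).trans (hgg p), npq.symm, nqr.symm,
    nrp.symm, fun x h1 h2 h3 => ?_⟩
  have hsupp : g.support = {p, g p, g (g p)} := by
    refine (Finset.eq_of_subset_of_card_le ?_ ?_).symm
    · intro y hy
      simp only [Finset.mem_insert, Finset.mem_singleton] at hy
      rcases hy with rfl | rfl | rfl <;> assumption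
    · rw [hg3, Finset.card_eq_three.2 ⟨_, _, _, npq.symm, nrp, nqr.symm, rfl⟩]
  have hx : g x = x := by
    rw [← Equiv.Perm.notMem_support, hsupp]
    simp [h1, h2, h3]
  have hcomm : ∀ y, g (τ y) = τ (g y) := fun y => congrArg (· y) hd.commute.eq
  simp only [Equiv.Perm.mul_apply, hcomm, hx, hτ']

/-- The genus-1 ramification type [1,3,2^*][2^*][2^*][2^*] is not realizable in any degree:
for even n ≥ 4 there are no permutations σ₁,…,σ₄ of {1,…,n} with σ₁ of full cycle type
[1,3,2^{(n-4)/2}], σ₂,σ₃,σ₄ fixed-point-free involutions, and σ₁σ₂σ₃σ₄ = 1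
(no transitivity assumed). -/
theorem stmt3 (n : ℕ) (hn : 4 ≤ n) (heven : Even n) :
    ¬ ∃ σ₁ σ₂ σ₃ σ₄ : Equiv.Perm (Fin n),
      fullCycleType σ₁ = 1 ::ₘ 3 ::ₘ Multiset.replicate ((n - 4) / 2) 2 ∧
      fullCycleType σ₂ = Multiset.replicate (n / 2) 2 ∧
      fullCycleType σ₃ = Multiset.replicate (n / 2) 2 ∧
      fullCycleType σ₄ = Multiset.replicate (n / 2) 2 ∧
      σ₁ * σ₂ * σ₃ * σ₄ = 1 := by
  rintro ⟨σ₁, a, b, c, h1, ha, hb, hc, hprod⟩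
  obtain ⟨haa, ha⟩ := involution_of_fullCycleType heven ha
  obtain ⟨hbb, hb⟩ := involution_of_fullCycleType heven hb
  obtain ⟨hcc, hc⟩ := involution_of_fullCycleType heven hc
  have hct : σ₁.cycleType = 3 ::ₘ Multiset.replicate ((n - 4) / 2) 2 := by
    rw [cycleType_eq_filter_fullCycleType, h1, Multiset.filter_cons_of_neg _ (by norm_num),
      Multiset.filter_eq_self]
    intro k hk
    rcases Multiset.mem_cons.1 hk with rfl | hk
    · norm_num
    · rw [Multiset.eq_of_mem_replicate hk]
  rw [← Equiv.Perm.cycleType_inv] at hct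
  obtain ⟨p, q, r, hpq, hqr, hrp, npq, nqr, nrp, hs⟩ := exists_three_cycle_of_cycleType hct
  refine false_of_involutions (s := σ₁⁻¹) ?_ haa ha hbb hb hcc hc hpq hqr hrp npq nqr nrp hs ?_
  · rw [eq_inv_iff_mul_eq_one, mul_eq_one_iff_eq_inv, eq_comm, inv_eq_iff_mul_eq_one, ← hprod]
    simp only [mul_assoc]
  · have hsum := (σ₁⁻¹).sum_cycleType
    rw [hct, Multiset.sum_cons, Multiset.sum_replicate, smul_eq_mul] at hsum
    have hcompl : (σ₁⁻¹).supportᶜ.card ≤ 1 := by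
      rw [Finset.card_compl, ← hsum, Fintype.card_fin]
      obtain ⟨m, rfl⟩ := heven
      omega
    have hmem : ∀ x, σ₁⁻¹ x = x → x ∈ (σ₁⁻¹).supportᶜ := fun x hx =>
      Finset.mem_compl.2 (Equiv.Perm.notMem_support.2 hx)
    intro x y hx hy
    exact Finset.card_le_one.1 hcompl x (hmem x hx) y (hmem y hy)
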